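/- Let lambda : V' -> ZMod d be an additive group homomorphism and let phi lie in Sp(V', omega'). Then the assignment Delta_v -> zeta^((lambda v).val) * Delta_(phi v) is right-definite: for all v1, v2 in V', Delta_(v1) = Delta_(v2) implies zeta^((lambda v1).val) * Delta_(phi v1) = zeta^((lambda v2).val) * Delta_(phi v2). Consequently there is a (unique) center-respecting function gamma : P' -> P' with gamma(Delta_v) = zeta^((lambda v).val) * Delta_(phi v) for all v in V'. -/

import Mathlib

noncomputable section

namespace PaperPCl

/-- `d' = 2d` if `d` is even, `d' = d` if `d` is odd. -/
def dp (d : ℕ) : ℕ := if Even d then 2 * d else d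

lemma d_dvd_dp (d : ℕ) : d ∣ dp d := by
  unfold dp; split
  · exact dvd_mul_left d 2
  · rfl

/-- The phase space `V = (ZMod d)^n × (ZMod d)^n`, vectors written `(q, p)`. -/
abbrev V (d n : ℕ) := (Fin n → ZMod d) × (Fin n → ZMod d)

/-- Dot product of two vectors in `(ZMod d)^n`. -/
def dotp {d n : ℕ} (p q : Fin n → ZMod d) : ZMod d := ∑ i, p i * q i

/-- The standard symplectic form `omega((q1,p1),(q2,p2)) = p1·q2 - p2·q1`. -/
def omegaF {d n : ℕ} (v w : V d n) : ZMod d := dotp v.2 w.1 - dotp w.2 v.1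

/-- Componentwise reduction mod `d`, `V' → V`. -/
def reduceV (d n : ℕ) (v : V (dp d) n) : V d n :=
  (fun i => ZMod.castHom (d_dvd_dp d) (ZMod d) (v.1 i),
   fun i => ZMod.castHom (d_dvd_dp d) (ZMod d) (v.2 i))

/-- Componentwise `val`-lift `V → V'`. -/
def liftV (d n : ℕ) (u : V d n) : V (dp d) n :=
  (fun i => ((u.1 i).val : ZMod (dp d)), fun i => ((u.2 i).val : ZMod (dp d)))

/-- `zeta = exp(2 pi i / d)`. -/
def zeta (d : ℕ) : ℂ := Complex.exp (2 * Real.pi * Complex.I / d)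

/-- `tau = exp(pi i / d)` if `d` is even, `tau = zeta^((d+1)/2)` if `d` is odd. -/
def tau (d : ℕ) : ℂ :=
  if Even d then Complex.exp (Real.pi * Complex.I / d) else zeta d ^ ((d + 1) / 2)

/-- The Pauli matrix `D_(q,p) = X^q Z^p`, a `d^n × d^n` complex matrix. -/
def Dop (d n : ℕ) [NeZero d] (u : V d n) : Matrix (Fin n → ZMod d) (Fin n → ZMod d) ℂ :=
  fun r s => if r = s + u.1 then zeta d ^ (dotp u.2 s).val else 0

/-- The displacement operator `Delta_v = tau^(q·p) D_(vbar)` for `v = (q,p) ∈ V'`. -/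
def Delta (d n : ℕ) [NeZero d] (v : V (dp d) n) : Matrix (Fin n → ZMod d) (Fin n → ZMod d) ℂ :=
  tau d ^ (dotp v.1 v.2).val • Dop d n (reduceV d n v)

/-- The large Pauli group `P'`: the subgroup of invertible `d^n × d^n` complex matrices
generated by the scalar matrix `tau • 1` together with all `D_u`, `u ∈ V`. -/
def Pgrp (d n : ℕ) [NeZero d] : Subgroup (Matrix (Fin n → ZMod d) (Fin n → ZMod d) ℂ)ˣ :=
  Subgroup.closure {x | (x : Matrix (Fin n → ZMod d) (Fin n → ZMod d) ℂ)
      = tau d • (1 : Matrix (Fin n → ZMod d) (Fin n → ZMod d) ℂ)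
    ∨ ∃ u : V d n, (x : Matrix (Fin n → ZMod d) (Fin n → ZMod d) ℂ) = Dop d n u}

/-- The underlying matrix of an element of `P'`. -/
def matVal {d n : ℕ} [NeZero d] (g : ↥(Pgrp d n)) : Matrix (Fin n → ZMod d) (Fin n → ZMod d) ℂ :=
  ((g : (Matrix (Fin n → ZMod d) (Fin n → ZMod d) ℂ)ˣ) : Matrix (Fin n → ZMod d) (Fin n → ZMod d) ℂ)

/-- A function `γ : P' → P'` is center-respecting if `γ(z*g) = z*γ(g)`
for every `z` in the center of `P'`. -/
def CenterResp {d n : ℕ} [NeZero d] (γ : ↥(Pgrp d n) → ↥(Pgrp d n)) : Prop :=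
  ∀ z ∈ Subgroup.center ↥(Pgrp d n), ∀ g, γ (z * g) = z * γ g

/-- A group automorphism of `P'` is projective Clifford if it fixes the center pointwise. -/
def IsPCl {d n : ℕ} [NeZero d] (γ : ↥(Pgrp d n) ≃* ↥(Pgrp d n)) : Prop :=
  ∀ z ∈ Subgroup.center ↥(Pgrp d n), γ z = z

/-- A linear automorphism is symplectic if it preserves the standard symplectic form. -/
def IsSymp (d n : ℕ) (ψ : V d n ≃ₗ[ZMod d] V d n) : Prop :=
  ∀ u v : V d n, omegaF (ψ u) (ψ v) = omegaF u v

/-- `b` is a standard basis vector of `V`. -/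
def IsStdBasis {d n : ℕ} (b : V d n) : Prop :=
  (∃ i : Fin n, b = (Pi.single i 1, 0)) ∨ (∃ i : Fin n, b = (0, Pi.single i 1))

instance neZero_dp (d : ℕ) [NeZero d] : NeZero (dp d) :=
  ⟨by unfold dp; have := NeZero.ne d; split <;> omega⟩

lemma two_mul_natCast_dp (d : ℕ) : (2 : ZMod (dp d)) * (d : ZMod (dp d)) = 0 := by
  have h : dp d ∣ 2 * d := by
    unfold dp; split
    · rfl
    · exact dvd_mul_left d 2
  exact_mod_cast (ZMod.natCast_eq_zero_iff (2 * d) (dp d)).2 h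

lemma natCast_mul_self_dp (d : ℕ) : (d : ZMod (dp d)) * (d : ZMod (dp d)) = 0 := by
  have h : dp d ∣ d * d := by
    unfold dp; split
    · next h => exact mul_dvd_mul h.two_dvd dvd_rfl
    · exact dvd_mul_left d d
  exact_mod_cast (ZMod.natCast_eq_zero_iff (d * d) (dp d)).2 h

lemma pow_natCast_val {M : Type*} [Monoid M] {m : ℕ} {z : M} (hz : z ^ m = 1) (a : ℕ) :
    z ^ (a : ZMod m).val = z ^ a := by
  rw [ZMod.val_natCast, ← pow_mod_orderOf z (a % m), Nat.mod_mod_of_dvd _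
    (orderOf_dvd_of_pow_eq_one hz), pow_mod_orderOf]

lemma pow_val_add {M : Type*} [Monoid M] {m : ℕ} [NeZero m] {z : M} (hz : z ^ m = 1)
    (x y : ZMod m) : z ^ (x + y).val = z ^ x.val * z ^ y.val := by
  rw [← pow_add, ← pow_natCast_val hz (x.val + y.val)]
  simp

lemma isPrimitiveRoot_zeta (d : ℕ) [NeZero d] : IsPrimitiveRoot (zeta d) d :=
  Complex.isPrimitiveRoot_exp d (NeZero.ne d)

lemma zeta_pow_val_injective (d : ℕ) [NeZero d] {x y : ZMod d}
    (h : zeta d ^ x.val = zeta d ^ y.val) : x = y :=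
  ZMod.val_injective d ((isPrimitiveRoot_zeta d).pow_inj (ZMod.val_lt x) (ZMod.val_lt y) h)

lemma zeta_pow_val_add (d : ℕ) [NeZero d] (x y : ZMod d) :
    zeta d ^ (x + y).val = zeta d ^ x.val * zeta d ^ y.val :=
  pow_val_add (isPrimitiveRoot_zeta d).pow_eq_one x y

lemma tau_sq (d : ℕ) [NeZero d] : tau d ^ 2 = zeta d := by
  unfold tau; split
  · rw [← Complex.exp_nat_mul, zeta]
    congr 1
    push_cast
    ring
  · next h =>
    rw [← pow_mul, show (d + 1) / 2 * 2 = d + 1 by grind, pow_succ,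
      (isPrimitiveRoot_zeta d).pow_eq_one, one_mul]

lemma tau_pow_dp (d : ℕ) [NeZero d] : tau d ^ dp d = 1 := by
  by_cases h : Even d
  · rw [dp, if_pos h, pow_mul, tau_sq, (isPrimitiveRoot_zeta d).pow_eq_one]
  · rw [dp, if_neg h, tau, if_neg h, ← pow_mul, mul_comm, pow_mul,
      (isPrimitiveRoot_zeta d).pow_eq_one, one_pow]

lemma tau_ne_zero (d : ℕ) [NeZero d] : tau d ≠ 0 := by
  intro h
  have := tau_pow_dp d
  rw [h, zero_pow (NeZero.ne _)] at this
  exact zero_ne_one this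

lemma zeta_ne_zero (d : ℕ) [NeZero d] : zeta d ≠ 0 := by
  rw [← tau_sq]
  exact pow_ne_zero _ (tau_ne_zero d)

lemma tau_pow_val_add (d : ℕ) [NeZero d] (x y : ZMod (dp d)) :
    tau d ^ (x + y).val = tau d ^ x.val * tau d ^ y.val :=
  pow_val_add (tau_pow_dp d) x y

lemma zeta_pow_eq_tau_pow_val (d : ℕ) [NeZero d] (k : ℕ) :
    zeta d ^ k = tau d ^ ((2 * k : ℕ) : ZMod (dp d)).val := by
  rw [pow_natCast_val (tau_pow_dp d), pow_mul, tau_sq]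

section dotp

variable {d n : ℕ}

lemma dotp_comm (p q : Fin n → ZMod d) : dotp p q = dotp q p :=
  dotProduct_comm p q

lemma dotp_add_right (p q r : Fin n → ZMod d) : dotp p (q + r) = dotp p q + dotp p r :=
  dotProduct_add p q r

lemma dotp_add_left (p q r : Fin n → ZMod d) : dotp (p + q) r = dotp p r + dotp q r :=
  add_dotProduct p q r

lemma dotp_smul_left (c : ZMod d) (p q : Fin n → ZMod d) : dotp (c • p) q = c * dotp p q :=
  smul_dotProduct c p q

lemma dotp_smul_right (c : ZMod d) (p q : Fin n → ZMod d) : dotp p (c • q) = c * dotp p q :=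
  dotProduct_smul c p q

lemma dotp_zero_left (q : Fin n → ZMod d) : dotp 0 q = 0 :=
  zero_dotProduct q

lemma dotp_zero_right (p : Fin n → ZMod d) : dotp p 0 = 0 :=
  dotProduct_zero p

lemma dotp_single (p : Fin n → ZMod d) (i : Fin n) : dotp p (Pi.single i 1) = p i :=
  dotProduct_single_one p i

end dotp

lemma map_add_natCast_smul {d n : ℕ} (lam : V (dp d) n →+ ZMod d) (v a : V (dp d) n) :
    lam (v + (d : ZMod (dp d)) • a) = lam v := by
  rw [Nat.cast_smul_eq_nsmul, map_add, map_nsmul, nsmul_eq_mul, CharP.cast_eq_zero, zero_mul,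
    add_zero]

lemma reduceV_add_smul {d n : ℕ} (v a : V (dp d) n) :
    reduceV d n (v + (d : ZMod (dp d)) • a) = reduceV d n v := by
  have h (x y : ZMod (dp d)) : ZMod.castHom (d_dvd_dp d) (ZMod d) (x + (d : ZMod (dp d)) * y) =
      ZMod.castHom (d_dvd_dp d) (ZMod d) x := by
    rw [map_add, map_mul, map_natCast, CharP.cast_eq_zero, zero_mul, add_zero]
  exact Prod.ext (funext fun i => h (v.1 i) (a.1 i)) (funext fun i => h (v.2 i) (a.2 i))

section Pauli

variable {d n : ℕ} [NeZero d]

lemma Dop_zero : Dop d n 0 = 1 := by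
  ext r s
  simp [Dop, Matrix.one_apply, dotp_zero_left]

lemma Dop_mul_Dop (u w : V d n) :
    Dop d n u * Dop d n w = zeta d ^ (dotp u.2 w.1).val • Dop d n (u + w) := by
  ext r s
  rw [Matrix.mul_apply, Finset.sum_eq_single (s + w.1)]
  · simp only [Dop, Matrix.smul_apply, if_true, Prod.fst_add, Prod.snd_add, smul_eq_mul,
      dotp_add_right, dotp_add_left, zeta_pow_val_add, show s + (u.1 + w.1) = s + w.1 + u.1 by abel]
    split
    · ring
    · simp
  · intro k _ hk
    simp [Dop, hk]
  · simp

lemma smul_Dop_inj {a b : ℂ} (hb : b ≠ 0) {u w : V d n} (h : a • Dop d n u = b • Dop d n w) :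
    u = w ∧ a = b := by
  have key (r s : Fin n → ZMod d) := congrFun (congrFun h r) s
  simp only [Dop, Matrix.smul_apply, smul_eq_mul] at key
  have h1 : u.1 = w.1 := by
    by_contra hne
    have := key w.1 0
    simp only [zero_add, if_true, if_neg (Ne.symm hne), mul_zero] at this
    exact mul_ne_zero hb (pow_ne_zero _ (zeta_ne_zero d)) this.symm
  have h2 (s : Fin n → ZMod d) := key (s + w.1) s
  simp only [h1, if_true] at h2
  have hab : a = b := by simpa [dotp_zero_right] using h2 0
  refine ⟨Prod.ext h1 (funext fun i => ?_), hab⟩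
  have h3 := h2 (Pi.single i 1)
  rw [hab, dotp_single, dotp_single] at h3
  exact zeta_pow_val_injective d (mul_left_cancel₀ hb h3)

lemma eq_zero_of_forall_commute_Dop {u : V d n} (h : ∀ w, Commute (Dop d n u) (Dop d n w)) :
    u = 0 := by
  have key (w : V d n) : dotp u.2 w.1 = dotp w.2 u.1 := by
    have := (h w).eq
    rw [Dop_mul_Dop, Dop_mul_Dop, add_comm w u] at this
    exact zeta_pow_val_injective d (smul_Dop_inj (pow_ne_zero _ (zeta_ne_zero d)) this).2
  refine Prod.ext (funext fun i => ?_) (funext fun i => ?_)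
  · simpa [dotp_zero_right, dotp_comm _ u.1, dotp_single] using (key (0, Pi.single i 1)).symm
  · simpa [dotp_zero_left, dotp_single] using key (Pi.single i 1, 0)

lemma exists_units_val_eq_smul_one {c : ℂ} (hc : c ≠ 0) :
    ∃ x : (Matrix (Fin n → ZMod d) (Fin n → ZMod d) ℂ)ˣ, x.val = c • 1 :=
  ⟨Units.mk0 c hc • 1, rfl⟩

lemma exists_units_val_eq_Dop (u : V d n) :
    ∃ x : (Matrix (Fin n → ZMod d) (Fin n → ZMod d) ℂ)ˣ, x.val = Dop d n u := by
  have h : IsUnit (Dop d n u) := by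
    rw [Matrix.isUnit_iff_isUnit_det]
    have h := congrArg Matrix.det (Dop_mul_Dop u (-u))
    rw [add_neg_cancel, Dop_zero, Matrix.det_mul, Matrix.det_smul, Matrix.det_one, mul_one] at h
    exact isUnit_iff_ne_zero.2 (left_ne_zero_of_mul
      (h ▸ pow_ne_zero _ (pow_ne_zero _ (zeta_ne_zero d))))
  exact ⟨h.unit, rfl⟩

lemma matVal_mul (g h : ↥(Pgrp d n)) : matVal (g * h) = matVal g * matVal h := rfl

lemma matVal_injective : Function.Injective (matVal : ↥(Pgrp d n) → _) := fun _ _ h =>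
  Subtype.ext (Units.ext h)

lemma exists_matVal_eq_Dop (u : V d n) : ∃ g : ↥(Pgrp d n), matVal g = Dop d n u := by
  obtain ⟨x, hx⟩ := exists_units_val_eq_Dop u
  exact ⟨⟨x, Subgroup.subset_closure (Or.inr ⟨u, hx⟩)⟩, hx⟩

lemma exists_matVal_eq_tau_pow (k : ℕ) : ∃ g : ↥(Pgrp d n), matVal g = tau d ^ k • 1 := by
  obtain ⟨x, hx⟩ := exists_units_val_eq_smul_one (d := d) (n := n) (tau_ne_zero d)
  refine ⟨⟨x, Subgroup.subset_closure (Or.inl hx)⟩ ^ k, ?_⟩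
  change (x ^ k).val = _
  rw [Units.val_pow_eq_pow_val, hx, smul_pow, one_pow]

lemma exists_matVal_eq_tau_pow_smul (k : ℕ) (g : ↥(Pgrp d n)) :
    ∃ h : ↥(Pgrp d n), matVal h = tau d ^ k • matVal g := by
  obtain ⟨z, hz⟩ := exists_matVal_eq_tau_pow (d := d) (n := n) k
  exact ⟨z * g, by rw [matVal_mul, hz, smul_mul_assoc, one_mul]⟩

lemma exists_matVal_eq_Delta (v : V (dp d) n) : ∃ g : ↥(Pgrp d n), matVal g = Delta d n v := by
  obtain ⟨g, hg⟩ := exists_matVal_eq_Dop (reduceV d n v)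
  obtain ⟨h, hh⟩ := exists_matVal_eq_tau_pow_smul (dotp v.1 v.2).val g
  exact ⟨h, by rw [hh, hg, Delta]⟩

lemma matVal_eq_tau_pow_smul_Dop (g : ↥(Pgrp d n)) :
    ∃ (x : ZMod (dp d)) (u : V d n), matVal g = tau d ^ x.val • Dop d n u := by
  obtain ⟨g, hg⟩ := g
  change ∃ (x : ZMod (dp d)) (u : V d n), g.val = _
  induction hg using Subgroup.closure_induction with
  | mem g hg =>
    rcases hg with h | ⟨u, h⟩
    · refine ⟨((1 : ℕ) : ZMod (dp d)), 0, ?_⟩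
      rw [pow_natCast_val (tau_pow_dp d), pow_one, Dop_zero, h]
    · exact ⟨0, u, by simp [h]⟩
  | one => exact ⟨0, 0, by simp [Dop_zero]⟩
  | mul g h _ _ hg hh =>
    obtain ⟨x, u, hx⟩ := hg
    obtain ⟨y, w, hy⟩ := hh
    refine ⟨x + y + ((2 * (dotp u.2 w.1).val : ℕ) : ZMod (dp d)), u + w, ?_⟩
    rw [Units.val_mul, hx, hy, smul_mul_smul_comm, Dop_mul_Dop, smul_smul,
      zeta_pow_eq_tau_pow_val, tau_pow_val_add, tau_pow_val_add]
  | inv g _ hg =>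
    obtain ⟨x, u, hx⟩ := hg
    refine ⟨-(x + ((2 * (dotp u.2 (-u).1).val : ℕ) : ZMod (dp d))), -u, ?_⟩
    apply Units.inv_eq_of_mul_eq_one_right
    rw [hx, smul_mul_smul_comm, Dop_mul_Dop, smul_smul, add_neg_cancel, Dop_zero,
      zeta_pow_eq_tau_pow_val, ← tau_pow_val_add, ← tau_pow_val_add,
      show ∀ a b : ZMod (dp d), a + -(a + b) + b = 0 by intros; ring]
    simp

lemma reduceV_liftV (u : V d n) : reduceV d n (liftV d n u) = u := by
  ext i <;> simp [reduceV, liftV]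

lemma matVal_eq_tau_pow_smul_Delta (g : ↥(Pgrp d n)) :
    ∃ (x : ZMod (dp d)) (v : V (dp d) n), matVal g = tau d ^ x.val • Delta d n v := by
  obtain ⟨x, u, hg⟩ := matVal_eq_tau_pow_smul_Dop g
  refine ⟨x - dotp (liftV d n u).1 (liftV d n u).2, liftV d n u, ?_⟩
  rw [Delta, smul_smul, ← tau_pow_val_add, sub_add_cancel, reduceV_liftV, hg]

lemma matVal_eq_of_mem_center {z : ↥(Pgrp d n)} (hz : z ∈ Subgroup.center ↥(Pgrp d n)) :
    ∃ x : ZMod (dp d), matVal z = tau d ^ x.val • 1 := by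
  obtain ⟨x, u, hx⟩ := matVal_eq_tau_pow_smul_Dop z
  have hu : u = 0 := eq_zero_of_forall_commute_Dop fun w => by
    obtain ⟨g, hg⟩ := exists_matVal_eq_Dop w
    have h := congrArg matVal (Subgroup.mem_center_iff.1 hz g)
    rw [matVal_mul, matVal_mul, hx, hg, smul_mul_assoc, mul_smul_comm] at h
    exact (smul_right_injective _ (pow_ne_zero _ (tau_ne_zero d)) h).symm
  exact ⟨x, by rw [hx, hu, Dop_zero]⟩

lemma mem_center_of_matVal_eq {z : ↥(Pgrp d n)} {c : ℂ} (hz : matVal z = c • 1) :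
    z ∈ Subgroup.center ↥(Pgrp d n) :=
  Subgroup.mem_center_iff.2 fun g => matVal_injective (by simp [matVal_mul, hz])

lemma exists_eq_add_smul_of_castHom_eq {x y : ZMod (dp d)}
    (h : ZMod.castHom (d_dvd_dp d) (ZMod d) x = ZMod.castHom (d_dvd_dp d) (ZMod d) y) :
    ∃ c : ZMod (dp d), y = x + (d : ZMod (dp d)) * c := by
  have h0 : ZMod.castHom (d_dvd_dp d) (ZMod d) (y - x) = 0 := by rw [map_sub, h, sub_self]
  rw [← ZMod.natCast_zmod_val (y - x), map_natCast, ZMod.natCast_eq_zero_iff] at h0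
  obtain ⟨c, hc⟩ := h0
  refine ⟨c, ?_⟩
  rw [← Nat.cast_mul, ← hc, ZMod.natCast_zmod_val]
  ring

lemma exists_eq_add_smul_of_reduceV_eq {v w : V (dp d) n} (h : reduceV d n v = reduceV d n w) :
    ∃ a : V (dp d) n, w = v + (d : ZMod (dp d)) • a := by
  have h1 (i : Fin n) := exists_eq_add_smul_of_castHom_eq (congrFun (congrArg Prod.fst h) i)
  have h2 (i : Fin n) := exists_eq_add_smul_of_castHom_eq (congrFun (congrArg Prod.snd h) i)
  choose a ha using h1
  choose b hb using h2
  exact ⟨(a, b), Prod.ext (funext ha) (funext hb)⟩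

/-- Translating by `d • a` changes `Delta` only by the sign `tau ^ (d * omega(v, a))`. -/
lemma Delta_add_smul (v a : V (dp d) n) :
    Delta d n (v + (d : ZMod (dp d)) • a) =
      tau d ^ ((d : ZMod (dp d)) * omegaF v a).val • Delta d n v := by
  rw [Delta, Delta, reduceV_add_smul, smul_smul, ← tau_pow_val_add]
  congr 3
  simp only [Prod.fst_add, Prod.snd_add, Prod.smul_fst, Prod.smul_snd, dotp_add_left,
    dotp_add_right, dotp_smul_left, dotp_smul_right, omegaF]
  rw [dotp_comm v.2 a.1, dotp_comm a.2 v.1]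
  linear_combination dotp v.1 a.2 * two_mul_natCast_dp d +
    dotp a.1 a.2 * natCast_mul_self_dp d

lemma tau_pow_smul_Delta_congr (lam : V (dp d) n →+ ZMod d)
    (φ : V (dp d) n ≃ₗ[ZMod (dp d)] V (dp d) n) (hφ : IsSymp (dp d) n φ)
    {x y : ZMod (dp d)} {v w : V (dp d) n}
    (h : tau d ^ x.val • Delta d n v = tau d ^ y.val • Delta d n w) :
    tau d ^ x.val • zeta d ^ (lam v).val • Delta d n (φ v) =
      tau d ^ y.val • zeta d ^ (lam w).val • Delta d n (φ w) := by
  have hτ (k : ℕ) : tau d ^ k ≠ 0 := pow_ne_zero _ (tau_ne_zero d)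
  have hvw : reduceV d n v = reduceV d n w := by
    rw [Delta, Delta, smul_smul, smul_smul] at h
    exact (smul_Dop_inj (mul_ne_zero (hτ _) (hτ _)) h).1
  obtain ⟨a, rfl⟩ := exists_eq_add_smul_of_reduceV_eq hvw
  have hxy : tau d ^ x.val = tau d ^ y.val * tau d ^ ((d : ZMod (dp d)) * omegaF v a).val := by
    rw [Delta_add_smul, Delta, smul_smul, smul_smul, smul_smul] at h
    exact mul_right_cancel₀ (hτ _) (smul_Dop_inj
      (mul_ne_zero (mul_ne_zero (hτ _) (hτ _)) (hτ _)) h).2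
  rw [map_add_natCast_smul, map_add, map_smul, Delta_add_smul, hφ, hxy, mul_smul,
    smul_comm (zeta d ^ _)]

end Pauli

theorem right_definite_of_symplectic (d n : ℕ) [NeZero d] (hd : 2 ≤ d) (hn : 1 ≤ n)
    (lam : V (dp d) n →+ ZMod d)
    (φ : V (dp d) n ≃ₗ[ZMod (dp d)] V (dp d) n) (hφ : IsSymp (dp d) n φ) :
    (∀ v1 v2 : V (dp d) n, Delta d n v1 = Delta d n v2 →
        zeta d ^ (lam v1).val • Delta d n (φ v1) = zeta d ^ (lam v2).val • Delta d n (φ v2)) ∧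
    ∃! γ : ↥(Pgrp d n) → ↥(Pgrp d n), CenterResp γ ∧
      ∀ v : V (dp d) n, ∀ g : ↥(Pgrp d n), matVal g = Delta d n v →
        matVal (γ g) = zeta d ^ (lam v).val • Delta d n (φ v) := by
  have hcongr {x y : ZMod (dp d)} {v w : V (dp d) n} :=
    tau_pow_smul_Delta_congr lam φ hφ (x := x) (y := y) (v := v) (w := w)
  refine ⟨fun v1 v2 h => by simpa using hcongr (x := 0) (y := 0) (by simpa using h), ?_⟩
  have hex (g : ↥(Pgrp d n)) : ∃ h : ↥(Pgrp d n), ∀ (x : ZMod (dp d)) (v : V (dp d) n),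
      matVal g = tau d ^ x.val • Delta d n v →
        matVal h = tau d ^ x.val • zeta d ^ (lam v).val • Delta d n (φ v) := by
    obtain ⟨x, v, hg⟩ := matVal_eq_tau_pow_smul_Delta g
    obtain ⟨k, hk⟩ := exists_matVal_eq_Delta (φ v)
    obtain ⟨h, hh⟩ := exists_matVal_eq_tau_pow_smul (x.val + 2 * (lam v).val) k
    refine ⟨h, fun y w hw => ?_⟩
    rw [← hcongr (hg.symm.trans hw), hh, hk, pow_add, pow_mul, tau_sq, mul_smul]
  choose γ hγ using hex
  refine ⟨γ, ⟨fun z hz g => matVal_injective ?_, fun v g hg => ?_⟩, ?_⟩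
  · obtain ⟨x, hx⟩ := matVal_eq_of_mem_center hz
    obtain ⟨y, v, hg⟩ := matVal_eq_tau_pow_smul_Delta g
    rw [matVal_mul, hγ g y v hg, hγ (z * g) (x + y) v, hx, tau_pow_val_add, smul_mul_assoc,
      one_mul, mul_smul]
    rw [matVal_mul, hx, hg, tau_pow_val_add, smul_mul_assoc, one_mul, mul_smul]
  · simpa using hγ g 0 v (by simpa using hg)
  · rintro γ' ⟨hcenter, hDelta⟩
    funext g
    obtain ⟨x, v, hg⟩ := matVal_eq_tau_pow_smul_Delta g
    obtain ⟨z, hz⟩ := exists_matVal_eq_tau_pow (d := d) (n := n) x.val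
    obtain ⟨k, hk⟩ := exists_matVal_eq_Delta v
    have hgk : g = z * k := matVal_injective (by
      rw [matVal_mul, hz, hk, hg, smul_mul_assoc, one_mul])
    apply matVal_injective
    rw [hγ g x v hg, hgk, hcenter z (mem_center_of_matVal_eq hz), matVal_mul, hz,
      hDelta v k hk, smul_mul_assoc, one_mul]

end PaperPCl
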